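/- Let p ≥ 3 and (β,h) be a p-regular point with unique global maximizer m_* of H = H_{β,h,p}. Then there exists a constant C > 0 such that for all N ≥ 1, sup_{x ∈ ℝ} | P( (S_N − N m_*)/√(−N/H''(m_*)) ≤ x ) − Φ(x) | ≤ C·N^{−1/2}. -/

import Mathlib

open Real MeasureTheory Filter
open scoped BigOperators Topology

noncomputable section

/-- The spin value (`±1`) of a Boolean coordinate. -/
def spin (b : Bool) : ℝ := if b then 1 else -1

/-- The total magnetization `S_N = ∑ᵢ Xᵢ` of a configuration. -/
def mag {N : ℕ} (x : Fin N → Bool) : ℝ := ∑ i, spin (x i)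

/-- The Hamiltonian of the `p`-spin Curie-Weiss model:
`β N^{1-p} ∑_{i₁,…,i_p} x_{i₁} ⋯ x_{i_p} + h ∑ᵢ xᵢ`. -/
def cwHamiltonian (p N : ℕ) (β h : ℝ) (x : Fin N → Bool) : ℝ :=
  β * (N : ℝ) ^ ((1 : ℤ) - (p : ℤ)) * (∑ i : Fin p → Fin N, ∏ j, spin (x (i j)))
    + h * mag x

/-- The (unnormalized) Gibbs weight of a configuration. -/
def cwWeight (p N : ℕ) (β h : ℝ) (x : Fin N → Bool) : ℝ :=
  Real.exp (cwHamiltonian p N β h x)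

/-- The probability of an event `E` under the `p`-spin Curie-Weiss measure `P_{β,h,p}`. -/
def cwProb (p N : ℕ) (β h : ℝ) (E : Set (Fin N → Bool)) : ℝ :=
  (∑ x : Fin N → Bool, E.indicator (cwWeight p N β h) x) /
    ∑ x : Fin N → Bool, cwWeight p N β h x

/-- Conditional probability of `E` given `A` under the `p`-spin Curie-Weiss measure. -/
def cwCondProb (p N : ℕ) (β h : ℝ) (E A : Set (Fin N → Bool)) : ℝ :=
  cwProb p N β h (E ∩ A) / cwProb p N β h A

/-- The binary entropy function `I(x) = ½[(1+x)log(1+x) + (1-x)log(1-x)]`. -/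
def binEnt (x : ℝ) : ℝ := (1/2) * ((1+x) * Real.log (1+x) + (1-x) * Real.log (1-x))

/-- The function `H_{β,h,p}(x) = βxᵖ + hx - I(x)`. -/
def Hfun (p : ℕ) (β h : ℝ) (x : ℝ) : ℝ := β * x ^ p + h * x - binEnt x

/-- `m` is a global maximizer of `H_{β,h,p}` on `[-1,1]`, lying in `(-1,1)`. -/
def isMaximizer (p : ℕ) (β h m : ℝ) : Prop :=
  m ∈ Set.Ioo (-1 : ℝ) 1 ∧ ∀ x ∈ Set.Icc (-1 : ℝ) 1, Hfun p β h x ≤ Hfun p β h m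

/-- `m` is the unique global maximizer of `H_{β,h,p}`. -/
def isUniqueMaximizer (p : ℕ) (β h m : ℝ) : Prop :=
  isMaximizer p β h m ∧ ∀ m', isMaximizer p β h m' → m' = m

/-- `(β,h)` is a `p`-regular point with unique global maximizer `m`. -/
def pRegular (p : ℕ) (β h m : ℝ) : Prop :=
  isUniqueMaximizer p β h m ∧ iteratedDeriv 2 (Hfun p β h) m < 0

/-- `(β,h)` is a `p`-special point with unique global maximizer `m`. -/
def pSpecial (p : ℕ) (β h m : ℝ) : Prop :=
  isUniqueMaximizer p β h m ∧ iteratedDeriv 2 (Hfun p β h) m = 0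

/-- `(β,h)` is a `p`-critical point: `H_{β,h,p}` has more than one global maximizer. -/
def pCritical (p : ℕ) (β h : ℝ) : Prop :=
  ∃ m₁ m₂, m₁ ≠ m₂ ∧ isMaximizer p β h m₁ ∧ isMaximizer p β h m₂

/-- The probability assigned to a set `S ⊆ ℝ` by the centered Gaussian with variance `v`. -/
def gaussProb (v : ℝ) (S : Set ℝ) : ℝ :=
  ∫ t in S, (Real.sqrt (2 * Real.pi * v))⁻¹ * Real.exp (-t ^ 2 / (2 * v))

/-- The CDF of the centered Gaussian with variance `v`. -/
def gaussCDF (v x : ℝ) : ℝ := gaussProb v (Set.Iic x)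

/-- The standard normal CDF `Φ`. -/
def stdNormCDF (x : ℝ) : ℝ := gaussCDF 1 x

/-- The CDF of the limit law `F` at a `p`-special point, where `c = H⁽⁴⁾(m_*)`:
`dF(x) = (2/Γ(1/4)) (-c/24)^{1/4} exp(c x⁴/24) dx`. -/
def specialCDF (c x : ℝ) : ℝ :=
  ∫ t in Set.Iic x, (2 / Real.Gamma (1/4)) * ((-c) / 24) ^ ((1:ℝ)/4) * Real.exp (c * t ^ 4 / 24)

/-- The inverse hyperbolic tangent `tanh⁻¹(t) = ½ log((1+t)/(1-t))`. -/
def arctanh (t : ℝ) : ℝ := (1/2) * Real.log ((1+t)/(1-t))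

/-- The function `g(t) = tanh⁻¹(t)/(p t^{p-1})`, so that the maximum pseudolikelihood
estimate of `β` is `g(X̄)`. -/
def gMPL (p : ℕ) (t : ℝ) : ℝ := arctanh t / (p * t ^ (p - 1))

/-- The threshold `β*(p) = inf{β ≥ 0 : sup_{x∈[0,1]} H_{β,0,p}(x) > 0}`. -/
def betaStar (p : ℕ) : ℝ := sInf {b : ℝ | 0 ≤ b ∧ ∃ x ∈ Set.Icc (0:ℝ) 1, 0 < Hfun p b 0 x}


lemma continuous_binEnt : Continuous binEnt := by
  unfold binEnt
  have h1 : Continuous fun x : ℝ => (1 + x) * Real.log (1 + x) :=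
    Real.continuous_mul_log.comp (continuous_const.add continuous_id)
  have h2 : Continuous fun x : ℝ => (1 - x) * Real.log (1 - x) :=
    Real.continuous_mul_log.comp (continuous_const.sub continuous_id)
  exact continuous_const.mul (h1.add h2)

lemma continuous_Hfun (p : ℕ) (β h : ℝ) : Continuous (Hfun p β h) := by
  unfold Hfun
  exact ((continuous_const.mul (continuous_id.pow p)).add (continuous_const.mul continuous_id)).sub
    continuous_binEnt

lemma analyticAt_Hfun (p : ℕ) (β h : ℝ) {m : ℝ} (hm : m ∈ Set.Ioo (-1 : ℝ) 1) :
    AnalyticAt ℝ (Hfun p β h) m := by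
  have h1 : AnalyticAt ℝ (fun x : ℝ => 1 + x) m := analyticAt_const.add analyticAt_id
  have h2 : AnalyticAt ℝ (fun x : ℝ => 1 - x) m := analyticAt_const.sub analyticAt_id
  have l1 := h1.log (by linarith [hm.1])
  have l2 := h2.log (by linarith [hm.2])
  exact ((analyticAt_const.mul (analyticAt_id.pow p)).add (analyticAt_const.mul analyticAt_id)).sub
    (analyticAt_const.mul ((h1.mul l1).add (h2.mul l2)))

/-- Second-order Taylor expansion of `H` at a maximizer, with a cubic remainder. -/
lemma exists_abs_Hfun_sub_le {p : ℕ} {β h m : ℝ} (hm : isMaximizer p β h m) :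
    ∃ C > 0, ∃ δ > 0, ∀ y, |y - m| ≤ δ →
      |Hfun p β h y - Hfun p β h m - iteratedDeriv 2 (Hfun p β h) m * (y - m) ^ 2 / 2|
        ≤ C * |y - m| ^ 3 := by
  have hd : deriv (Hfun p β h) m = 0 := by
    apply IsLocalMax.deriv_eq_zero
    filter_upwards [Ioo_mem_nhds hm.1.1 hm.1.2] with x hx
    exact hm.2 x ⟨hx.1.le, hx.2.le⟩
  have hO := (analyticAt_Hfun p β h hm.1).hasFPowerSeriesAt.isBigO_sub_partialSum_pow 3
  obtain ⟨C, hC, hb⟩ := hO.exists_pos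
  rw [Asymptotics.IsBigOWith, Metric.eventually_nhds_iff] at hb
  obtain ⟨r, hr, hb⟩ := hb
  refine ⟨C, hC, r / 2, by positivity, fun y hy => ?_⟩
  have := @hb (y - m) (by rw [dist_zero_right, Real.norm_eq_abs]; linarith)
  simp only [FormalMultilinearSeries.partialSum, Finset.sum_range_succ, Finset.sum_range_zero,
    FormalMultilinearSeries.ofScalars_apply_eq, iteratedDeriv_zero, iteratedDeriv_one, hd,
    Real.norm_eq_abs, smul_eq_mul] at this
  norm_num [abs_pow] at this
  convert this using 2
  ring_nf

/-- The entropy term makes `H` increase strictly when moving inwards from an endpoint. -/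
lemma exists_Hfun_lt_of_endpoint (p : ℕ) {β h e : ℝ} (hβ : 0 < β) (hh : 0 < h)
    (he : e = 1 ∨ e = -1) :
    ∃ y ∈ Set.Icc (-1 : ℝ) 1, Hfun p β h e < Hfun p β h y := by
  set L : ℝ := β * p + h with hL
  have hLpos : 0 < L := by positivity
  set s : ℝ := Real.exp (-2 * L - 1) with hs
  have s0 : 0 < s := Real.exp_pos _
  have s1 : s < 1 := by rw [hs, Real.exp_lt_one_iff]; linarith
  have hlog : Real.log s = -2 * L - 1 := Real.log_exp _
  have hlog2 : Real.log (2 - s) ≤ Real.log 2 := Real.log_le_log (by linarith) (by linarith)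
  have hb := one_add_mul_le_pow (a := -s) (by linarith) p
  have hb1 : (1 + -s) ^ p ≤ 1 := pow_le_one₀ (by linarith) (by linarith)
  have l2 : 0 < Real.log 2 := Real.log_pos (by norm_num)
  have key : (2 - s) * Real.log (2 - s) ≤ (2 - s) * Real.log 2 :=
    mul_le_mul_of_nonneg_left hlog2 (by linarith)
  have hsl : 0 < s * Real.log 2 := by positivity
  have hp0 : (0 : ℝ) ≤ p := p.cast_nonneg
  refine ⟨e * (1 - s), ?_, ?_⟩
  · rcases he with rfl | rfl <;> constructor <;> linarith
  · have hent : binEnt (e * (1 - s)) ≤ binEnt e - s * L - s / 2 := by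
      rcases he with rfl | rfl
      · have : binEnt (1 * (1 - s)) = 1 / 2 * ((2 - s) * Real.log (2 - s) + s * Real.log s) := by
          unfold binEnt; ring_nf
        rw [this, hlog]
        have : binEnt 1 = Real.log 2 := by norm_num [binEnt]; ring
        rw [this]; linarith
      · have : binEnt (-1 * (1 - s)) = 1 / 2 * ((2 - s) * Real.log (2 - s) + s * Real.log s) := by
          unfold binEnt; ring_nf
        rw [this, hlog]
        have : binEnt (-1) = Real.log 2 := by norm_num [binEnt]; ring
        rw [this]; linarith
    have hpow : |(e * (1 - s)) ^ p - e ^ p| ≤ p * s := by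
      have he1 : |e| = 1 := by rcases he with rfl | rfl <;> simp
      have : (e * (1 - s)) ^ p - e ^ p = e ^ p * ((1 + -s) ^ p - 1) := by
        rw [mul_pow]; ring
      rw [this, abs_mul, abs_pow, he1, one_pow, one_mul, abs_le]
      have : 0 ≤ p * s := by positivity
      constructor <;> linarith
    have h1 := mul_le_mul_of_nonneg_left (abs_le.1 hpow).1 hβ.le
    have h2 : -(h * s) ≤ h * (e * (1 - s)) - h * e := by
      have : h * (e * (1 - s)) - h * e = -(h * s) * e := by ring
      rw [this]
      have : 0 < h * s := by positivity
      rcases he with rfl | rfl <;> linarith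
    unfold Hfun
    nlinarith

lemma Hfun_lt_of_ne {p : ℕ} {β h m y : ℝ} (hβ : 0 < β) (hh : 0 < h)
    (hm : isUniqueMaximizer p β h m) (hy : y ∈ Set.Icc (-1 : ℝ) 1) (hne : y ≠ m) :
    Hfun p β h y < Hfun p β h m := by
  refine lt_of_le_of_ne (hm.1.2 y hy) fun heq => ?_
  by_cases he : y = 1 ∨ y = -1
  · obtain ⟨z, hz, hlt⟩ := exists_Hfun_lt_of_endpoint p hβ hh he
    linarith [hm.1.2 z hz]
  · push Not at he
    exact hne (hm.2 y ⟨⟨lt_of_le_of_ne hy.1 (Ne.symm he.2), lt_of_le_of_ne hy.2 he.1⟩,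
      fun x hx => heq ▸ hm.1.2 x hx⟩)

/-- Away from its unique maximizer, `H` is bounded away from its maximum. -/
lemma exists_Hfun_le_sub {p : ℕ} {β h m : ℝ} (hβ : 0 < β) (hh : 0 < h)
    (hm : isUniqueMaximizer p β h m) {δ : ℝ} (hδ : 0 < δ) :
    ∃ ε > 0, ∀ y ∈ Set.Icc (-1 : ℝ) 1, δ ≤ |y - m| → Hfun p β h y ≤ Hfun p β h m - ε := by
  set K : Set ℝ := Set.Icc (-1) 1 ∩ {y | δ ≤ |y - m|} with hK
  have hKc : IsCompact K := isCompact_Icc.inter_right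
    (isClosed_le continuous_const (continuous_id.sub continuous_const).abs)
  rcases K.eq_empty_or_nonempty with h0 | h0
  · refine ⟨1, one_pos, fun y hy hy' => ?_⟩
    have : y ∈ K := ⟨hy, hy'⟩
    simp [h0] at this
  · obtain ⟨z, hz, hmax⟩ := hKc.exists_isMaxOn h0 (continuous_Hfun p β h).continuousOn
    have hzm : z ≠ m := by
      rintro rfl
      have := hz.2
      simp only [Set.mem_ofPred_eq, sub_self, abs_zero] at this
      linarith
    refine ⟨Hfun p β h m - Hfun p β h z, sub_pos.2 (Hfun_lt_of_ne hβ hh hm hz.1 hzm), ?_⟩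
    intro y hy hy'
    have : Hfun p β h y ≤ Hfun p β h z := hmax (show y ∈ K from ⟨hy, hy'⟩)
    linarith

/-- The logarithm of the ratio between the binomial coefficient `N.choose k` and its entropy
approximation. -/
def entropyDefect (N k : ℕ) : ℝ :=
  Real.log (N.choose k) + k * Real.log k + ((N - k : ℕ) : ℝ) * Real.log ((N - k : ℕ) : ℝ)
    - N * Real.log N

lemma entropyDefect_zero (N : ℕ) : entropyDefect N 0 = 0 := by
  simp [entropyDefect]

lemma mul_log_succ_sub_mem (k : ℕ) :
    (k : ℝ) * (Real.log (k + 1) - Real.log k) ∈ Set.Icc (1 - ((k : ℝ) + 1)⁻¹) 1 := by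
  rcases Nat.eq_zero_or_pos k with rfl | hk
  · simp
  · have hk' : (0 : ℝ) < k := by exact_mod_cast hk
    have e : Real.log (k + 1) - Real.log k = Real.log (((k : ℝ) + 1) / k) :=
      (Real.log_div (by positivity) (by positivity)).symm
    rw [e]
    have h1 := Real.one_sub_inv_le_log_of_pos (x := ((k : ℝ) + 1) / k) (by positivity)
    have h2 := Real.log_le_sub_one_of_pos (x := ((k : ℝ) + 1) / k) (by positivity)
    constructor
    · refine le_trans (le_of_eq ?_) (mul_le_mul_of_nonneg_left h1 hk'.le)
      field_simp
      ring
    · refine (mul_le_mul_of_nonneg_left h2 hk'.le).trans (le_of_eq ?_)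
      field_simp
      ring

lemma abs_entropyDefect_succ_sub_le {N k : ℕ} (hk : k < N) :
    |entropyDefect N (k + 1) - entropyDefect N k| ≤
      ((k : ℝ) + 1)⁻¹ + (((N - 1 - k : ℕ) : ℝ) + 1)⁻¹ := by
  obtain ⟨j, rfl⟩ : ∃ j, N = k + 1 + j := ⟨N - (k + 1), by omega⟩
  have e1 : k + 1 + j - (k + 1) = j := by omega
  have e2 : k + 1 + j - k = j + 1 := by omega
  have e3 : k + 1 + j - 1 - k = j := by omega
  have hch : Real.log ((k + 1 + j).choose (k + 1)) + Real.log (k + 1) =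
      Real.log ((k + 1 + j).choose k) + Real.log (j + 1) := by
    have h1 := Nat.choose_succ_right_eq (k + 1 + j) k
    rw [e2] at h1
    have p1 : 0 < (k + 1 + j).choose (k + 1) := Nat.choose_pos (by omega)
    have p2 : 0 < (k + 1 + j).choose k := Nat.choose_pos (by omega)
    rw [← Real.log_mul (by positivity) (by positivity), ← Real.log_mul (by positivity) (by positivity)]
    exact_mod_cast congrArg (fun n : ℕ => Real.log (n : ℝ)) h1
  have a := mul_log_succ_sub_mem k
  have b := mul_log_succ_sub_mem j
  have hd : entropyDefect (k + 1 + j) (k + 1) - entropyDefect (k + 1 + j) k =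
      (k : ℝ) * (Real.log (k + 1) - Real.log k) - (j : ℝ) * (Real.log (j + 1) - Real.log j) := by
    unfold entropyDefect
    rw [e1, e2]
    push_cast
    linear_combination hch
  rw [hd, e3, abs_le]
  have i1 : (0 : ℝ) < ((k : ℝ) + 1)⁻¹ := by positivity
  have i2 : (0 : ℝ) < ((j : ℝ) + 1)⁻¹ := by positivity
  constructor <;> linarith [a.1, a.2, b.1, b.2]

lemma abs_entropyDefect_le {N k : ℕ} (hk : k ≤ N) :
    |entropyDefect N k| ≤ 2 * (1 + Real.log N) := by
  have hH : ∑ i ∈ Finset.range N, ((i : ℝ) + 1)⁻¹ ≤ 1 + Real.log N := by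
    have := harmonic_le_one_add_log N
    simpa [harmonic] using this
  have hH' : ∑ i ∈ Finset.range N, (((N - 1 - i : ℕ) : ℝ) + 1)⁻¹ ≤ 1 + Real.log N := by
    rw [Finset.sum_range_reflect (fun i : ℕ => ((i : ℝ) + 1)⁻¹) N]
    exact hH
  have ht : entropyDefect N k =
      ∑ i ∈ Finset.range k, (entropyDefect N (i + 1) - entropyDefect N i) := by
    rw [Finset.sum_range_sub, entropyDefect_zero, sub_zero]
  rw [ht]
  calc _ ≤ ∑ i ∈ Finset.range k, |entropyDefect N (i + 1) - entropyDefect N i| :=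
        Finset.abs_sum_le_sum_abs _ _
    _ ≤ ∑ i ∈ Finset.range k, (((i : ℝ) + 1)⁻¹ + (((N - 1 - i : ℕ) : ℝ) + 1)⁻¹) :=
        Finset.sum_le_sum fun i hi => abs_entropyDefect_succ_sub_le
          (lt_of_lt_of_le (Finset.mem_range.1 hi) hk)
    _ ≤ ∑ i ∈ Finset.range N, (((i : ℝ) + 1)⁻¹ + (((N - 1 - i : ℕ) : ℝ) + 1)⁻¹) :=
        Finset.sum_le_sum_of_subset_of_nonneg (Finset.range_mono hk)
          fun i _ _ => by positivity
    _ ≤ _ := by rw [Finset.sum_add_distrib]; linarith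

/-- In the bulk, the entropy defect is Lipschitz with constant of order `1 / N`. -/
lemma abs_entropyDefect_sub_le {N k l : ℕ} {c : ℝ} (hc : 0 < c) (hN : 1 ≤ N) (hkl : k ≤ l)
    (hk : c * N ≤ k) (hl : c * N ≤ (N : ℝ) - l) :
    |entropyDefect N l - entropyDefect N k| ≤ 2 / c * ((l - k) / N) := by
  have hN' : (0 : ℝ) < N := by exact_mod_cast hN
  induction l, hkl using Nat.le_induction with
  | base => simp
  | succ l hkl ih =>
    push_cast at hl ⊢
    have hlN : l < N := by
      have : (l : ℝ) < N := by nlinarith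
      exact_mod_cast this
    have hkl' : (k : ℝ) ≤ l := by exact_mod_cast hkl
    have h1 := ih (by linarith)
    have h2 := abs_entropyDefect_succ_sub_le hlN
    have hcN : 0 < c * N := by positivity
    have h3 : ((l : ℝ) + 1)⁻¹ ≤ (c * N)⁻¹ := inv_anti₀ hcN (by linarith)
    have h4 : (((N - 1 - l : ℕ) : ℝ) + 1)⁻¹ ≤ (c * N)⁻¹ := by
      apply inv_anti₀ hcN
      have : ((N - 1 - l : ℕ) : ℝ) + 1 = N - l := by
        have : N - 1 - l + 1 + l = N := by omega
        have : ((N - 1 - l : ℕ) : ℝ) + 1 + l = N := by exact_mod_cast this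
        linarith
      rw [this]; linarith
    have h5 := abs_sub_le (entropyDefect N (l + 1)) (entropyDefect N l) (entropyDefect N k)
    have h6 : 2 / c * (((l : ℝ) + 1 - k) / N) = 2 / c * ((l - k) / N) + 2 * (c * N)⁻¹ := by
      field_simp
      ring
    rw [h6]
    linarith

/-- The total Gibbs weight of the configurations with exactly `k` coordinates equal to `+1`. -/
def levelWeight (p N : ℕ) (β h : ℝ) (k : ℕ) : ℝ :=
  N.choose k * Real.exp (N * (β * ((2 * k - N) / N) ^ p + h * ((2 * k - N) / N)))

lemma mag_eq {N : ℕ} (x : Fin N → Bool) :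
    mag x = 2 * ((Finset.univ.filter fun i => x i = true).card : ℝ) - N := by
  have : ∀ i, spin (x i) = 2 * (if x i = true then 1 else 0) - 1 := by
    intro i
    unfold spin
    split_ifs <;> norm_num
  unfold mag
  simp_rw [this]
  rw [Finset.sum_sub_distrib, ← Finset.mul_sum, Finset.sum_boole]
  simp

lemma cwHamiltonian_eq (p : ℕ) {N : ℕ} (hN : 1 ≤ N) (β h : ℝ) (x : Fin N → Bool) :
    cwHamiltonian p N β h x = N * (β * (mag x / N) ^ p + h * (mag x / N)) := by
  have hN' : (N : ℝ) ≠ 0 := by positivity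
  unfold cwHamiltonian
  rw [← Fintype.sum_pow (fun i => spin (x i)) p, ← mag, zpow_sub₀ hN', zpow_one, zpow_natCast,
    div_pow]
  field_simp

lemma sum_bool_config_eq (N : ℕ) (f : ℕ → ℝ) :
    ∑ x : Fin N → Bool, f (Finset.univ.filter fun i => x i = true).card =
      ∑ k ∈ Finset.range (N + 1), N.choose k * f k := by
  have h1 := Finset.sum_powerset_apply_card f (x := (Finset.univ : Finset (Fin N)))
  rw [Finset.card_univ, Fintype.card_fin, Finset.powerset_univ] at h1
  simp only [nsmul_eq_mul] at h1
  rw [← h1]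
  refine Finset.sum_bij' (fun x _ => Finset.univ.filter fun i => x i = true)
    (fun s _ i => decide (i ∈ s)) ?_ ?_ ?_ ?_ ?_ <;> simp

lemma cwProb_mag_eq (p : ℕ) {N : ℕ} (hN : 1 ≤ N) (β h : ℝ) (s : Set ℝ) [DecidablePred (· ∈ s)] :
    cwProb p N β h {x | mag x ∈ s} =
      (∑ k ∈ (Finset.range (N + 1)).filter (fun k : ℕ => 2 * (k : ℝ) - N ∈ s),
        levelWeight p N β h k) / ∑ k ∈ Finset.range (N + 1), levelWeight p N β h k := by
  unfold cwProb
  congr 1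
  · have := sum_bool_config_eq N (fun k => if 2 * (k : ℝ) - N ∈ s then
      Real.exp (N * (β * ((2 * k - N) / N) ^ p + h * ((2 * k - N) / N))) else 0)
    rw [Finset.sum_filter]
    convert this using 2 with x _ k _
    · simp only [Set.indicator_apply, cwWeight, cwHamiltonian_eq p hN, Set.mem_ofPred_eq, mag_eq]
    · unfold levelWeight
      split_ifs <;> simp
  · have := sum_bool_config_eq N (fun k =>
      Real.exp (N * (β * ((2 * k - N) / N) ^ p + h * ((2 * k - N) / N))))
    convert this using 2 with x _ k _
    · rw [cwWeight, cwHamiltonian_eq p hN, mag_eq]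
    · rfl

lemma levelWeight_eq_exp (p : ℕ) {N k : ℕ} (hN : 1 ≤ N) (hk : k ≤ N) (β h : ℝ) :
    levelWeight p N β h k =
      Real.exp (N * Real.log 2 + N * Hfun p β h ((2 * k - N) / N) + entropyDefect N k) := by
  have hN' : (0 : ℝ) < N := by exact_mod_cast hN
  have hch : (0 : ℝ) < N.choose k := by exact_mod_cast Nat.choose_pos hk
  have hmul : ∀ a : ℝ, 0 ≤ a → 2 * a / N * Real.log (2 * a / N) =
      2 * a / N * (Real.log 2 + Real.log a - Real.log N) := by
    intro a ha
    rcases ha.eq_or_lt with rfl | ha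
    · simp
    · rw [Real.log_div (by positivity) hN'.ne', Real.log_mul (by norm_num) ha.ne']
  have hbin : N * binEnt ((2 * k - N) / N) =
      N * Real.log 2 + k * Real.log k + ((N - k : ℕ) : ℝ) * Real.log ((N - k : ℕ) : ℝ)
        - N * Real.log N := by
    have e1 : 1 + (2 * (k : ℝ) - N) / N = 2 * k / N := by field_simp; ring
    have e2 : 1 - (2 * (k : ℝ) - N) / N = 2 * ((N - k : ℕ) : ℝ) / N := by
      rw [Nat.cast_sub hk]; field_simp; ring
    unfold binEnt
    rw [e1, e2, hmul _ (Nat.cast_nonneg _), hmul _ (Nat.cast_nonneg _), Nat.cast_sub hk]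
    field_simp
    ring
  have : (N : ℝ) * Real.log 2 + N * Hfun p β h ((2 * k - N) / N) + entropyDefect N k =
      Real.log (N.choose k) + N * (β * ((2 * k - N) / N) ^ p + h * ((2 * k - N) / N)) := by
    unfold Hfun entropyDefect
    linear_combination -hbin
  rw [this, Real.exp_add, Real.exp_log hch, levelWeight]

lemma abs_exp_add_sub_exp_le (a e : ℝ) :
    |Real.exp (a + e) - Real.exp a| ≤ |e| * Real.exp (a + |e|) := by
  have h1 : |Real.exp e - 1| ≤ |e| * Real.exp |e| := by
    rcases le_total 0 e with he | he
    · rw [abs_of_nonneg he, abs_of_nonneg (by linarith [Real.one_le_exp he])]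
      have h2 := Real.add_one_le_exp (-e)
      have h3 := mul_le_mul_of_nonneg_right h2 (Real.exp_pos e).le
      rw [← Real.exp_add, neg_add_cancel, Real.exp_zero] at h3
      linarith
    · rw [abs_of_nonpos he, abs_of_nonpos (by linarith [Real.exp_le_one_iff.2 he])]
      have h2 := Real.add_one_le_exp e
      have h3 : 1 ≤ Real.exp (-e) := Real.one_le_exp (by linarith)
      nlinarith
  have e1 : Real.exp (a + e) - Real.exp a = Real.exp a * (Real.exp e - 1) := by
    rw [Real.exp_add]; ring
  rw [e1, abs_mul, abs_of_pos (Real.exp_pos a), Real.exp_add]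
  nlinarith [Real.exp_pos a]

lemma exists_cubic_mul_exp_le {A B b : ℝ} (hA : 0 < A) (hB : 0 < B) (hb : 0 < b) :
    ∃ K > 0, ∀ s : ℝ, 0 ≤ s →
      (A * s ^ 3 + B * s + 2 * B) * Real.exp (-b * s ^ 2) ≤ K * Real.exp (-(b / 2) * s ^ 2) := by
  refine ⟨(A + 3 * B) * (1 + 8 / b ^ 2), by positivity, fun s hs => ?_⟩
  set u : ℝ := b / 2 * s ^ 2 with hu
  have hu0 : 0 ≤ u := by positivity
  have hq := Real.quadratic_le_exp_of_nonneg hu0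
  have h3 : s ^ 3 ≤ 1 + s ^ 4 := by
    nlinarith [sq_nonneg (s ^ 2 - s), sq_nonneg (s - 1), sq_nonneg (s ^ 2 - 1), sq_nonneg s]
  have h1 : s ≤ 1 + s ^ 4 := by nlinarith [sq_nonneg (s ^ 2 - 1), sq_nonneg (s - 1)]
  have h4 : 1 + s ^ 4 ≤ (1 + 8 / b ^ 2) * Real.exp u := by
    have e : s ^ 4 = 8 / b ^ 2 * (u ^ 2 / 2) := by rw [hu]; field_simp; ring
    have p1 : 0 < 8 / b ^ 2 := by positivity
    rw [e]
    nlinarith [mul_le_mul_of_nonneg_left (show u ^ 2 / 2 ≤ Real.exp u by linarith) p1.le]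
  have h5 : A * s ^ 3 + B * s + 2 * B ≤ (A + 3 * B) * (1 + s ^ 4) := by
    have : 0 ≤ s ^ 4 := by positivity
    nlinarith
  have h6 : A * s ^ 3 + B * s + 2 * B ≤ (A + 3 * B) * (1 + 8 / b ^ 2) * Real.exp u := by
    rw [mul_assoc]
    exact h5.trans (mul_le_mul_of_nonneg_left h4 (by positivity))
  have e2 : Real.exp (-(b / 2) * s ^ 2) = Real.exp u * Real.exp (-b * s ^ 2) := by
    rw [← Real.exp_add]; congr 1; rw [hu]; ring
  rw [e2, ← mul_assoc]
  exact mul_le_mul_of_nonneg_right h6 (Real.exp_pos _).le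

/-- A cubic perturbation of the Gaussian exponent changes the density by `O(N ^ (-1/2))`. -/
lemma exists_abs_exp_perturb_le {A B l : ℝ} (hA : 0 < A) (hB : 0 < B) (hl : 0 < l) :
    ∃ K > 0, ∀ (N : ℕ) (d e : ℝ), 1 ≤ N → |d| ≤ 1 → A * |d| ≤ l / 4 →
      |e| ≤ N * (A * |d| ^ 3) + B * (|d| + 2 / N) →
      |Real.exp (-(l * N * d ^ 2 / 2) + e) - Real.exp (-(l * N * d ^ 2 / 2))| ≤
        K / √N * Real.exp (-(l / 8) * (N * d ^ 2)) := by
  obtain ⟨K, hK, hb⟩ := exists_cubic_mul_exp_le hA hB (show 0 < l / 4 by positivity)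
  refine ⟨Real.exp (3 * B) * K, by positivity, fun N d e hN hd hAd he => ?_⟩
  have hN1 : (1 : ℝ) ≤ N := by exact_mod_cast hN
  set q : ℝ := √N with hq
  have hq1 : 1 ≤ q := Real.one_le_sqrt.2 hN1
  have hqq : (N : ℝ) = q ^ 2 := (Real.sq_sqrt (by positivity)).symm
  set s : ℝ := q * |d| with hs
  have hs0 : 0 ≤ s := by positivity
  have hs2 : s ^ 2 = N * d ^ 2 := by rw [hs, mul_pow, sq_abs, hqq]
  have hN2 : 2 / (N : ℝ) ≤ 2 := by rw [div_le_iff₀ (by positivity)]; linarith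
  have he1 : |e| ≤ l * N * d ^ 2 / 4 + 3 * B := by
    have : (N : ℝ) * (A * |d| ^ 3) = N * d ^ 2 * (A * |d|) := by rw [← sq_abs d]; ring
    have h2 : (N : ℝ) * d ^ 2 * (A * |d|) ≤ N * d ^ 2 * (l / 4) :=
      mul_le_mul_of_nonneg_left hAd (by positivity)
    nlinarith
  have he2 : |e| ≤ (A * s ^ 3 + B * s + 2 * B) / q := by
    refine he.trans ?_
    rw [le_div_iff₀ (by positivity), hqq, hs]
    have h1 : B * (2 / q ^ 2) * q ≤ 2 * B := by
      have : B * (2 / q ^ 2) * q = 2 * B / q := by field_simp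
      rw [this, div_le_iff₀ (by positivity)]
      nlinarith
    nlinarith
  refine (abs_exp_add_sub_exp_le _ _).trans ?_
  calc |e| * Real.exp (-(l * N * d ^ 2 / 2) + |e|)
      ≤ (A * s ^ 3 + B * s + 2 * B) / q * Real.exp (3 * B + -(l / 4) * s ^ 2) := by
        apply mul_le_mul he2 _ (Real.exp_pos _).le (by positivity)
        apply Real.exp_le_exp.2
        rw [hs2]
        linarith
    _ = Real.exp (3 * B) / q * ((A * s ^ 3 + B * s + 2 * B) * Real.exp (-(l / 4) * s ^ 2)) := by
        rw [Real.exp_add]; ring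
    _ ≤ Real.exp (3 * B) / q * (K * Real.exp (-(l / 4 / 2) * s ^ 2)) :=
        mul_le_mul_of_nonneg_left (hb s hs0) (by positivity)
    _ = _ := by rw [hs2]; ring_nf

/-- Exponentially small weights far from the centre are dominated by the Gaussian error term. -/
lemma exists_exp_far_le {ε : ℝ} (hε : 0 < ε) :
    ∃ K > 0, ∀ (N : ℕ) (d : ℝ), 1 ≤ N → |d| ≤ 2 →
      Real.exp (-(N * ε) + 4 * (1 + Real.log N)) ≤
        K / √N * Real.exp (-(ε / 8) * (N * d ^ 2)) := by
  refine ⟨Real.exp 4 * (120 * (2 / ε) ^ 5), by positivity, fun N d hN hd => ?_⟩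
  have hN1 : (1 : ℝ) ≤ N := by exact_mod_cast hN
  have hN0 : (0 : ℝ) < N := by linarith
  have hsq : √(N : ℝ) ≤ N := by
    rw [Real.sqrt_le_left hN0.le]; nlinarith
  have hd2 : d ^ 2 ≤ 4 := by
    rw [← sq_abs]; nlinarith [abs_nonneg d]
  have h5 := Real.pow_div_factorial_le_exp (x := N * ε / 2) (by positivity) 5
  have e5 : (N : ℝ) ^ 5 ≤ 120 * (2 / ε) ^ 5 * Real.exp (N * ε / 2) := by
    have : (N : ℝ) ^ 5 = 120 * (2 / ε) ^ 5 * ((N * ε / 2) ^ 5 / (Nat.factorial 5 : ℕ)) := by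
      norm_num [Nat.factorial]
      field_simp
    rw [this]
    exact mul_le_mul_of_nonneg_left h5 (by positivity)
  have e4 : Real.exp (4 * Real.log N) = (N : ℝ) ^ 4 := by
    rw [show (4 : ℝ) * Real.log N = ((4 : ℕ) : ℝ) * Real.log N by norm_num, Real.exp_nat_mul,
      Real.exp_log hN0]
  have e6 : (N : ℝ) ^ 4 * Real.exp (-(N * ε / 2)) ≤ 120 * (2 / ε) ^ 5 / √N := by
    rw [le_div_iff₀ (by positivity)]
    calc (N : ℝ) ^ 4 * Real.exp (-(N * ε / 2)) * √N
        ≤ (N : ℝ) ^ 4 * Real.exp (-(N * ε / 2)) * N :=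
          mul_le_mul_of_nonneg_left hsq (by positivity)
      _ = (N : ℝ) ^ 5 * Real.exp (-(N * ε / 2)) := by ring
      _ ≤ 120 * (2 / ε) ^ 5 * Real.exp (N * ε / 2) * Real.exp (-(N * ε / 2)) :=
          mul_le_mul_of_nonneg_right e5 (Real.exp_pos _).le
      _ = _ := by rw [mul_assoc, ← Real.exp_add]; simp
  calc Real.exp (-(N * ε) + 4 * (1 + Real.log N))
      = Real.exp 4 * (N ^ 4 * Real.exp (-(N * ε / 2))) * Real.exp (-(N * ε / 2)) := by
        rw [← e4, ← Real.exp_add, ← Real.exp_add, ← Real.exp_add]; ring_nf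
    _ ≤ Real.exp 4 * (120 * (2 / ε) ^ 5 / √N) * Real.exp (-(ε / 8) * (N * d ^ 2)) := by
        apply mul_le_mul (mul_le_mul_of_nonneg_left e6 (by positivity)) _ (Real.exp_pos _).le
          (by positivity)
        apply Real.exp_le_exp.2
        have : ε / 8 * (N * d ^ 2) ≤ ε / 8 * (N * 4) := by gcongr
        linarith
    _ = _ := by ring

lemma gaussian_far_le {l δ : ℝ} (hl : 0 < l) (hδ : 0 < δ) {N : ℕ} {d : ℝ} (hN : 1 ≤ N)
    (hd : δ ≤ |d|) :
    Real.exp (-(l * N * d ^ 2 / 2)) ≤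
      4 / (l * δ ^ 2) / √N * Real.exp (-(l / 4) * (N * d ^ 2)) := by
  have hN1 : (1 : ℝ) ≤ N := by exact_mod_cast hN
  have hN0 : (0 : ℝ) < N := by linarith
  have hsq : √(N : ℝ) ≤ N := by
    rw [Real.sqrt_le_left hN0.le]; nlinarith
  have hd2 : δ ^ 2 ≤ d ^ 2 := by rw [← sq_abs d]; gcongr
  have h1 := Real.add_one_le_exp (l * N * d ^ 2 / 4)
  have h2 : √(N : ℝ) * (l * δ ^ 2 / 4) ≤ Real.exp (l * N * d ^ 2 / 4) := by
    have : √(N : ℝ) * (l * δ ^ 2 / 4) ≤ N * (l * d ^ 2 / 4) := by gcongr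
    linarith
  have e1 : Real.exp (-(l * N * d ^ 2 / 2)) =
      Real.exp (-(l * N * d ^ 2 / 4)) * Real.exp (-(l / 4) * (N * d ^ 2)) := by
    rw [← Real.exp_add]; ring_nf
  rw [e1]
  refine mul_le_mul_of_nonneg_right ?_ (Real.exp_pos _).le
  rw [Real.exp_neg]
  refine (inv_anti₀ (by positivity) h2).trans (le_of_eq ?_)
  field_simp

/-- Local Gaussian approximation of the level weights, with an error that is uniform over all
levels. -/
lemma exists_abs_levelWeight_div_sub_le {p : ℕ} {β h m : ℝ} (hβ : 0 < β) (hh : 0 < h)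
    (hreg : pRegular p β h m) :
    ∃ C > 0, ∃ c > 0, ∃ N₀ : ℕ, ∀ N : ℕ, 1 ≤ N → N₀ ≤ N → ∃ A > 0, ∀ k ≤ N,
      |levelWeight p N β h k / A -
        Real.exp (-(-iteratedDeriv 2 (Hfun p β h) m * N * ((2 * k - N) / N - m) ^ 2 / 2))| ≤
        C / √N * Real.exp (-c * (N * ((2 * k - N) / N - m) ^ 2)) := by
  obtain ⟨hu, hneg⟩ := hreg
  obtain ⟨hm1, hm2⟩ := hu.1.1
  set l : ℝ := -iteratedDeriv 2 (Hfun p β h) m with hl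
  have hl0 : 0 < l := by linarith
  obtain ⟨C₁, hC₁, δ₁, hδ₁, hT⟩ := exists_abs_Hfun_sub_le hu.1
  set g : ℝ := min (1 + m) (1 - m) / 4 with hg
  have hg0 : 0 < g := by
    have : 0 < min (1 + m) (1 - m) := lt_min (by linarith) (by linarith)
    positivity
  have hgm1 : 4 * g ≤ 1 + m := by rw [hg]; linarith [min_le_left (1 + m) (1 - m)]
  have hgm2 : 4 * g ≤ 1 - m := by rw [hg]; linarith [min_le_right (1 + m) (1 - m)]
  obtain ⟨δ, hδ, hδ1, hδT, hδg, hδl⟩ : ∃ δ > 0, δ ≤ 1 ∧ δ ≤ δ₁ ∧ δ ≤ 2 * g ∧ C₁ * δ ≤ l / 4 := by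
    refine ⟨min (min 1 δ₁) (min (2 * g) (l / 4 / C₁)), by positivity, ?_, ?_, ?_, ?_⟩
    · exact (min_le_left _ _).trans (min_le_left _ _)
    · exact (min_le_left _ _).trans (min_le_right _ _)
    · exact (min_le_right _ _).trans (min_le_left _ _)
    · have := (min_le_right (min 1 δ₁) (min (2 * g) (l / 4 / C₁))).trans (min_le_right _ _)
      rwa [le_div_iff₀ hC₁, mul_comm] at this
  obtain ⟨ε, hε, hgap⟩ := exists_Hfun_le_sub hβ hh hu hδ
  obtain ⟨K₁, hK₁, hloc⟩ := exists_abs_exp_perturb_le hC₁ (inv_pos.2 hg0) hl0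
  obtain ⟨K₂, hK₂, hfar⟩ := exists_exp_far_le hε
  set K₃ : ℝ := 4 / (l * δ ^ 2) with hK₃'
  have hK₃ : 0 < K₃ := by positivity
  refine ⟨K₁ + K₂ + K₃, by positivity, min (l / 8) (ε / 8), by positivity, ⌈2 / δ⌉₊, ?_⟩
  intro N hN hN₀
  have hN1 : (1 : ℝ) ≤ N := by exact_mod_cast hN
  have hN0 : (0 : ℝ) < N := by linarith
  have hNδ : 2 / (N : ℝ) ≤ δ := by
    rw [div_le_iff₀ hN0, mul_comm, ← div_le_iff₀ hδ]
    exact Nat.ceil_le.1 hN₀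
  set k₀ : ℕ := ⌊(N : ℝ) * (1 + m) / 2⌋₊ with hk₀
  have hpos : 0 ≤ (N : ℝ) * (1 + m) / 2 := by
    have : 0 < 1 + m := by linarith
    positivity
  have hk1 : (k₀ : ℝ) ≤ (N : ℝ) * (1 + m) / 2 := Nat.floor_le hpos
  have hk2 : (N : ℝ) * (1 + m) / 2 < k₀ + 1 := Nat.lt_floor_add_one _
  have hk₀N : k₀ ≤ N := by
    have : (k₀ : ℝ) ≤ N := by nlinarith
    exact_mod_cast this
  have hy₀ : |(2 * (k₀ : ℝ) - N) / N - m| ≤ 2 / N := by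
    have : (2 * (k₀ : ℝ) - N) / N - m = (2 * k₀ - N * (1 + m)) / N := by field_simp; ring
    rw [this, abs_div, abs_of_pos hN0]
    gcongr
    rw [abs_le]
    constructor <;> linarith
  have hbulk : ∀ k : ℕ, |(2 * (k : ℝ) - N) / N - m| ≤ δ →
      g * N ≤ k ∧ g * N ≤ (N : ℝ) - k := by
    intro k hk
    have e : (2 * (k : ℝ) - N) / N * N = 2 * k - N := by field_simp
    obtain ⟨h1, h2⟩ := abs_le.1 hk
    constructor <;> nlinarith
  refine ⟨Real.exp (N * Real.log 2 + N * Hfun p β h m + entropyDefect N k₀), Real.exp_pos _, ?_⟩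
  intro k hk
  have hkN : (k : ℝ) ≤ N := by exact_mod_cast hk
  have hk0 : (0 : ℝ) ≤ k := k.cast_nonneg
  rw [levelWeight_eq_exp p hN hk, ← Real.exp_sub]
  set y : ℝ := (2 * (k : ℝ) - N) / N with hy
  have hyI : y ∈ Set.Icc (-1 : ℝ) 1 := by
    rw [hy]
    constructor
    · rw [le_div_iff₀ hN0]; linarith
    · rw [div_le_iff₀ hN0]; linarith
  set d : ℝ := y - m with hd
  have hweak : ∀ b ≥ min (l / 8) (ε / 8), ∀ K > 0, K / √N * Real.exp (-b * (N * d ^ 2)) ≤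
      K / √N * Real.exp (-min (l / 8) (ε / 8) * (N * d ^ 2)) := by
    intro b hb K hK
    have : 0 ≤ (N : ℝ) * d ^ 2 := by positivity
    gcongr
  have hsplit : (K₁ + K₂ + K₃) / √N * Real.exp (-min (l / 8) (ε / 8) * (N * d ^ 2)) =
      K₁ / √N * Real.exp (-min (l / 8) (ε / 8) * (N * d ^ 2)) +
      K₂ / √N * Real.exp (-min (l / 8) (ε / 8) * (N * d ^ 2)) +
      K₃ / √N * Real.exp (-min (l / 8) (ε / 8) * (N * d ^ 2)) := by ring
  have hn : ∀ K > 0, 0 ≤ K / √N * Real.exp (-min (l / 8) (ε / 8) * (N * d ^ 2)) :=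
    fun K hK => by positivity
  rw [hsplit]
  by_cases hcase : |d| ≤ δ
  · have hLip : |entropyDefect N k - entropyDefect N k₀| ≤ g⁻¹ * (|d| + 2 / N) := by
      obtain ⟨a1, a2⟩ := hbulk k hcase
      obtain ⟨b1, b2⟩ := hbulk k₀ (hy₀.trans hNδ)
      have hdist : |((k : ℝ) - k₀) / N| ≤ (|d| + 2 / N) / 2 := by
        have : ((k : ℝ) - k₀) / N = (d - ((2 * (k₀ : ℝ) - N) / N - m)) / 2 := by
          rw [hd, hy]; field_simp; ring
        rw [this, abs_div, abs_two]
        have := abs_sub d ((2 * (k₀ : ℝ) - N) / N - m)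
        linarith
      have hfin : 2 / g * |((k : ℝ) - k₀) / N| ≤ g⁻¹ * (|d| + 2 / N) := by
        refine (mul_le_mul_of_nonneg_left hdist (by positivity)).trans (le_of_eq ?_)
        field_simp
      refine le_trans ?_ hfin
      rcases le_total k₀ k with hle | hle
      · refine (abs_entropyDefect_sub_le hg0 hN hle b1 a2).trans ?_
        exact mul_le_mul_of_nonneg_left (le_abs_self _) (by positivity)
      · rw [abs_sub_comm]
        refine (abs_entropyDefect_sub_le hg0 hN hle a1 b2).trans ?_
        refine mul_le_mul_of_nonneg_left ?_ (by positivity)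
        rw [← abs_neg, ← neg_div, neg_sub]
        exact le_abs_self _
    have hHt := hT y (hcase.trans hδT)
    set e : ℝ := N * (Hfun p β h y - Hfun p β h m - iteratedDeriv 2 (Hfun p β h) m * d ^ 2 / 2)
      + (entropyDefect N k - entropyDefect N k₀) with he
    have he1 : |e| ≤ N * (C₁ * |d| ^ 3) + g⁻¹ * (|d| + 2 / N) := by
      refine (abs_add_le _ _).trans (add_le_add ?_ hLip)
      rw [abs_mul, abs_of_pos hN0]
      exact mul_le_mul_of_nonneg_left hHt hN0.le
    have := hloc N d e hN (hcase.trans hδ1)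
      ((mul_le_mul_of_nonneg_left hcase hC₁.le).trans hδl) he1
    have heq : N * Real.log 2 + N * Hfun p β h y + entropyDefect N k -
        (N * Real.log 2 + N * Hfun p β h m + entropyDefect N k₀) = -(l * N * d ^ 2 / 2) + e := by
      rw [he, hl]; ring
    rw [heq]
    linarith [hweak (l / 8) (min_le_left _ _) K₁ hK₁, hn K₂ hK₂, hn K₃ hK₃]
  · have hd' : δ ≤ |d| := (not_le.1 hcase).le
    have hd2 : |d| ≤ 2 := by
      rw [abs_le, hd]; constructor <;> linarith [hyI.1, hyI.2]
    have h1 := hfar N d hN hd2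
    have h2 := gaussian_far_le hl0 hδ hN hd'
    have h3 : Real.exp (N * Real.log 2 + N * Hfun p β h y + entropyDefect N k -
        (N * Real.log 2 + N * Hfun p β h m + entropyDefect N k₀)) ≤
        Real.exp (-(N * ε) + 4 * (1 + Real.log N)) := by
      apply Real.exp_le_exp.2
      have a1 := (abs_le.1 (abs_entropyDefect_le hk)).2
      have a2 := (abs_le.1 (abs_entropyDefect_le hk₀N)).1
      have a3 := mul_le_mul_of_nonneg_left (hgap y hyI hd') hN0.le
      linarith
    have p1 := Real.exp_pos (N * Real.log 2 + N * Hfun p β h y + entropyDefect N k -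
        (N * Real.log 2 + N * Hfun p β h m + entropyDefect N k₀))
    have p2 := Real.exp_pos (-(l * N * d ^ 2 / 2))
    have w2 := hweak (ε / 8) (min_le_right _ _) K₂ hK₂
    have w3 := hweak (l / 4) ((min_le_left _ _).trans (by linarith)) K₃ hK₃
    have w1 := hn K₁ hK₁
    rw [abs_le]
    constructor <;> linarith [hn K₂ hK₂, hn K₃ hK₃]

lemma integrable_exp_neg_sq_div_two : Integrable fun t : ℝ => Real.exp (-t ^ 2 / 2) := by
  convert integrable_exp_neg_mul_sq (b := 1 / 2) (by norm_num) using 2 with t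
  ring_nf

lemma integral_exp_neg_sq_div_two : ∫ t : ℝ, Real.exp (-t ^ 2 / 2) = √(2 * π) := by
  have := integral_gaussian (1 / 2)
  rw [show π / (1 / 2) = 2 * π by ring] at this
  rw [← this]
  congr 1
  ext t
  ring_nf

lemma setIntegral_gaussian_tail_le {S : Set ℝ} (hS : MeasurableSet S) {s : ℝ} (hs : 0 < s)
    (h : ∀ t ∈ S, s ≤ |t|) :
    ∫ t in S, Real.exp (-t ^ 2 / 2) ≤ √(4 * π) / s := by
  have hint := integrable_exp_neg_mul_sq (b := 1 / 4) (by norm_num)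
  have h1 : ∀ t ∈ S, Real.exp (-t ^ 2 / 2) ≤ s⁻¹ * Real.exp (-(1 / 4) * t ^ 2) := by
    intro t ht
    have h2 : s ^ 2 ≤ t ^ 2 := by rw [← sq_abs t]; gcongr; exact h t ht
    have e1 : Real.exp (-t ^ 2 / 2) = Real.exp (-(t ^ 2 / 4)) * Real.exp (-(1 / 4) * t ^ 2) := by
      rw [← Real.exp_add]; ring_nf
    rw [e1, Real.exp_neg]
    refine mul_le_mul_of_nonneg_right (inv_anti₀ hs ?_) (Real.exp_pos _).le
    nlinarith [Real.add_one_le_exp (t ^ 2 / 4), sq_nonneg (s - 2)]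
  calc ∫ t in S, Real.exp (-t ^ 2 / 2) ≤ ∫ t in S, s⁻¹ * Real.exp (-(1 / 4) * t ^ 2) :=
        setIntegral_mono_on integrable_exp_neg_sq_div_two.integrableOn
          (hint.const_mul _).integrableOn hS h1
    _ ≤ ∫ t, s⁻¹ * Real.exp (-(1 / 4) * t ^ 2) :=
        setIntegral_le_integral (hint.const_mul _) (ae_of_all _ fun t => by positivity)
    _ = √(4 * π) / s := by
        rw [integral_const_mul, integral_gaussian, show π / (1 / 4) = 4 * π by ring]
        ring

/-- The unnormalized Gaussian distribution function. -/
def gaussMass (x : ℝ) : ℝ := ∫ t in Set.Iic x, Real.exp (-t ^ 2 / 2)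

lemma gaussMass_nonneg (x : ℝ) : 0 ≤ gaussMass x :=
  integral_nonneg fun _ => (Real.exp_pos _).le

lemma gaussMass_sub (a b : ℝ) :
    gaussMass b - gaussMass a = ∫ t in a..b, Real.exp (-t ^ 2 / 2) :=
  intervalIntegral.integral_Iic_sub_Iic integrable_exp_neg_sq_div_two.integrableOn
    integrable_exp_neg_sq_div_two.integrableOn

lemma gaussMass_mono : Monotone gaussMass := fun a b hab => by
  have := gaussMass_sub a b
  have h2 : 0 ≤ ∫ t in a..b, Real.exp (-t ^ 2 / 2) :=
    intervalIntegral.integral_nonneg hab fun _ _ => (Real.exp_pos _).le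
  linarith

lemma gaussMass_sub_le {a b : ℝ} (hab : a ≤ b) : gaussMass b - gaussMass a ≤ b - a := by
  rw [gaussMass_sub]
  have : ∫ t in a..b, Real.exp (-t ^ 2 / 2) ≤ ∫ _ in a..b, (1 : ℝ) := by
    refine intervalIntegral.integral_mono_on hab
      integrable_exp_neg_sq_div_two.intervalIntegrable intervalIntegrable_const fun t _ => ?_
    rw [Real.exp_le_one_iff]
    nlinarith [sq_nonneg t]
  simpa using this

lemma gaussMass_add_Ioi (x : ℝ) :
    gaussMass x + ∫ t in Set.Ioi x, Real.exp (-t ^ 2 / 2) = √(2 * π) := by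
  rw [← integral_exp_neg_sq_div_two]
  exact intervalIntegral.integral_Iic_add_Ioi integrable_exp_neg_sq_div_two.integrableOn
    integrable_exp_neg_sq_div_two.integrableOn

lemma gaussMass_le (x : ℝ) : gaussMass x ≤ √(2 * π) := by
  have : 0 ≤ ∫ t in Set.Ioi x, Real.exp (-t ^ 2 / 2) := integral_nonneg fun _ => (Real.exp_pos _).le
  linarith [gaussMass_add_Ioi x]

lemma gaussMass_le_of_le_neg {x s : ℝ} (hs : 0 < s) (hx : x ≤ -s) :
    gaussMass x ≤ √(4 * π) / s :=
  setIntegral_gaussian_tail_le measurableSet_Iic hs fun t ht => by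
    have : t ≤ x := ht
    rw [le_abs]; right; linarith

lemma le_gaussMass_add_of_le {x s : ℝ} (hs : 0 < s) (hx : s ≤ x) :
    √(2 * π) ≤ gaussMass x + √(4 * π) / s := by
  have : ∫ t in Set.Ioi x, Real.exp (-t ^ 2 / 2) ≤ √(4 * π) / s :=
    setIntegral_gaussian_tail_le measurableSet_Ioi hs fun t ht => by
      have : x < t := ht
      rw [le_abs]; left; linarith
  linarith [gaussMass_add_Ioi x]

lemma stdNormCDF_eq (x : ℝ) : stdNormCDF x = gaussMass x / √(2 * π) := by
  unfold stdNormCDF gaussCDF gaussProb gaussMass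
  rw [integral_const_mul, mul_one, mul_one]
  ring

/-- Replacing a Gaussian weight by its value at a nearby grid point costs `O(r)`. -/
lemma exists_abs_sub_gaussian_le {C c D : ℝ} (hC : 0 < C) (hc : 0 < c) (hD : 0 < D) :
    ∃ K > 0, ∃ b > 0, ∀ r s t w : ℝ, 0 < r → r ≤ 1 → |t - s| ≤ D * r →
      |w - Real.exp (-s ^ 2 / 2)| ≤ C * r * Real.exp (-c * s ^ 2) →
      |w - Real.exp (-t ^ 2 / 2)| ≤ K * r * Real.exp (-b * t ^ 2) := by
  obtain ⟨K, hK, hb⟩ := exists_cubic_mul_exp_le (A := 1) (B := 1 + D) (b := 1 / 4) one_pos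
    (by positivity) (by norm_num)
  refine ⟨C * Real.exp (c * D ^ 2) + D * Real.exp (2 * D ^ 2) * K, by positivity,
    min (c / 2) (1 / 8), by positivity, fun r s t w hr hr1 hst hw => ?_⟩
  have hDr : D * r ≤ D := by nlinarith
  have hst' : |t - s| ≤ D := hst.trans hDr
  have hsq : (t - s) ^ 2 ≤ D ^ 2 := by rw [← sq_abs]; gcongr
  have h1 : Real.exp (-c * s ^ 2) ≤
      Real.exp (c * D ^ 2) * Real.exp (-min (c / 2) (1 / 8) * t ^ 2) := by
    rw [← Real.exp_add]
    apply Real.exp_le_exp.2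
    have a1 : t ^ 2 ≤ 2 * s ^ 2 + 2 * D ^ 2 := by nlinarith [sq_nonneg (t - 2 * s)]
    have a2 : min (c / 2) (1 / 8) * t ^ 2 ≤ c / 2 * t ^ 2 := by gcongr; exact min_le_left _ _
    nlinarith
  have h2 : |Real.exp (-s ^ 2 / 2) - Real.exp (-t ^ 2 / 2)| ≤
      D * Real.exp (2 * D ^ 2) * K * r * Real.exp (-min (c / 2) (1 / 8) * t ^ 2) := by
    set e : ℝ := (t ^ 2 - s ^ 2) / 2 with he
    have e1 : -s ^ 2 / 2 = -t ^ 2 / 2 + e := by rw [he]; ring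
    have he1 : |e| ≤ |t - s| * (|t| + D) := by
      have : e = (t - s) * ((2 * t - (t - s)) / 2) := by rw [he]; ring
      rw [this, abs_mul]
      refine mul_le_mul_of_nonneg_left ?_ (abs_nonneg _)
      rw [abs_div, abs_two]
      have a1 := abs_sub (2 * t) (t - s)
      rw [abs_mul, abs_two] at a1
      linarith
    have he2 : |e| ≤ D * r * (|t| + D) :=
      he1.trans (mul_le_mul_of_nonneg_right hst (by positivity))
    have he3 : |e| ≤ t ^ 2 / 4 + 2 * D ^ 2 := by
      have : |e| ≤ D * (|t| + D) := he1.trans (mul_le_mul_of_nonneg_right hst' (by positivity))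
      rw [← sq_abs t]
      nlinarith [sq_nonneg (|t| / 2 - D)]
    have hcub := hb |t| (abs_nonneg t)
    rw [sq_abs] at hcub
    have hle : |t| + D ≤ 1 * |t| ^ 3 + (1 + D) * |t| + 2 * (1 + D) := by
      have : 0 ≤ |t| ^ 3 := by positivity
      nlinarith [abs_nonneg t]
    rw [e1]
    calc _ ≤ |e| * Real.exp (-t ^ 2 / 2 + |e|) := abs_exp_add_sub_exp_le _ _
      _ ≤ D * r * (|t| + D) * Real.exp (2 * D ^ 2 + -(1 / 4) * t ^ 2) := by
          apply mul_le_mul he2 (Real.exp_le_exp.2 (by linarith)) (Real.exp_pos _).le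
            (by positivity)
      _ = D * r * Real.exp (2 * D ^ 2) * ((|t| + D) * Real.exp (-(1 / 4) * t ^ 2)) := by
          rw [Real.exp_add]; ring
      _ ≤ D * r * Real.exp (2 * D ^ 2) * (K * Real.exp (-(1 / 4 / 2) * t ^ 2)) :=
          mul_le_mul_of_nonneg_left
            ((mul_le_mul_of_nonneg_right hle (Real.exp_pos _).le).trans hcub) (by positivity)
      _ ≤ D * r * Real.exp (2 * D ^ 2) * (K * Real.exp (-min (c / 2) (1 / 8) * t ^ 2)) := by
          gcongr
          exact (min_le_right _ _).trans (by norm_num)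
      _ = _ := by ring
  have h3 := abs_sub_le w (Real.exp (-s ^ 2 / 2)) (Real.exp (-t ^ 2 / 2))
  have h4 : C * r * Real.exp (-c * s ^ 2) ≤
      C * r * (Real.exp (c * D ^ 2) * Real.exp (-min (c / 2) (1 / 8) * t ^ 2)) :=
    mul_le_mul_of_nonneg_left h1 (by positivity)
  nlinarith

/-- Riemann sums of weights close to the Gaussian density approximate Gaussian integrals. -/
lemma exists_abs_sum_sub_gaussMass_le {C c D : ℝ} (hC : 0 < C) (hc : 0 < c) (hD : 0 < D) :
    ∃ K > 0, ∀ (r t₀ : ℝ) (w : ℕ → ℝ) (n : ℕ), 0 < r → r ≤ 1 →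
      (∀ k < n, |w k - Real.exp (-(t₀ + k * (D * r)) ^ 2 / 2)| ≤
        C * r * Real.exp (-c * (t₀ + k * (D * r)) ^ 2)) →
      |∑ k ∈ Finset.range n, D * r * w k - (gaussMass (t₀ + n * (D * r)) - gaussMass t₀)| ≤
        K * r := by
  obtain ⟨K, hK, b, hb, hcell⟩ := exists_abs_sub_gaussian_le hC hc hD
  have hgi := integrable_exp_neg_mul_sq hb
  refine ⟨K * √(π / b), by positivity, fun r t₀ w n hr hr1 hw => ?_⟩
  set Δ : ℝ := D * r with hΔ
  have hΔ0 : 0 < Δ := by positivity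
  set τ : ℕ → ℝ := fun k => t₀ + k * Δ with hτ
  have hstep : ∀ k, τ (k + 1) - τ k = Δ := fun k => by simp only [hτ]; push_cast; ring
  have hle : ∀ k, τ k ≤ τ (k + 1) := fun k => by linarith [hstep k]
  have h0 : τ 0 = t₀ := by simp [hτ]
  have hcellint : ∀ k < n, |Δ * w k - ∫ t in τ k..τ (k + 1), Real.exp (-t ^ 2 / 2)| ≤
      ∫ t in τ k..τ (k + 1), K * r * Real.exp (-b * t ^ 2) := by
    intro k hk
    have e1 : Δ * w k = ∫ _ in τ k..τ (k + 1), w k := by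
      rw [intervalIntegral.integral_const, hstep, smul_eq_mul]
    rw [e1, ← intervalIntegral.integral_sub intervalIntegrable_const
      integrable_exp_neg_sq_div_two.intervalIntegrable, ← Real.norm_eq_abs]
    refine intervalIntegral.norm_integral_le_of_norm_le (hle k) (ae_of_all _ fun t ht => ?_)
      (hgi.const_mul _).intervalIntegrable
    refine hcell r (τ k) t (w k) hr hr1 ?_ (hw k hk)
    rw [abs_le]
    have := hstep k
    constructor <;> linarith [ht.1, ht.2]
  have hs1 : ∑ k ∈ Finset.range n, ∫ t in τ k..τ (k + 1), Real.exp (-t ^ 2 / 2) =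
      gaussMass (τ n) - gaussMass (τ 0) := by
    rw [gaussMass_sub]
    exact intervalIntegral.sum_integral_adjacent_intervals fun k _ =>
      integrable_exp_neg_sq_div_two.intervalIntegrable
  have hs2 : ∑ k ∈ Finset.range n, ∫ t in τ k..τ (k + 1), K * r * Real.exp (-b * t ^ 2) =
      ∫ t in τ 0..τ n, K * r * Real.exp (-b * t ^ 2) :=
    intervalIntegral.sum_integral_adjacent_intervals fun k _ =>
      (hgi.const_mul _).intervalIntegrable
  rw [show t₀ + n * Δ = τ n from rfl, ← h0, ← hs1, ← Finset.sum_sub_distrib]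
  refine (Finset.abs_sum_le_sum_abs _ _).trans
    ((Finset.sum_le_sum fun k hk => hcellint k (Finset.mem_range.1 hk)).trans ?_)
  have hmono : τ 0 ≤ τ n := (monotone_nat_of_le_succ hle) (Nat.zero_le n)
  rw [hs2, intervalIntegral.integral_of_le hmono]
  refine (setIntegral_le_integral (hgi.const_mul _)
    (ae_of_all _ fun t => by positivity)).trans (le_of_eq ?_)
  rw [integral_const_mul, integral_gaussian]
  ring

lemma exists_forall_le_iff_lt {t₀ Δ : ℝ} (hΔ : 0 ≤ Δ) (x : ℝ) (n : ℕ) :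
    ∃ K ≤ n, ∀ k < n, t₀ + k * Δ ≤ x ↔ k < K := by
  induction n with
  | zero => exact ⟨0, le_rfl, fun k hk => absurd hk (Nat.not_lt_zero k)⟩
  | succ n ih =>
    by_cases hx : t₀ + n * Δ ≤ x
    · refine ⟨n + 1, le_rfl, fun k hk => ⟨fun _ => hk, fun _ => ?_⟩⟩
      have : (k : ℝ) ≤ n := by exact_mod_cast Nat.lt_succ_iff.1 hk
      nlinarith
    · obtain ⟨K, hK, h⟩ := ih
      refine ⟨K, by omega, fun k hk => ?_⟩
      rcases Nat.lt_succ_iff_lt_or_eq.1 hk with hk | rfl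
      · exact h k hk
      · exact ⟨fun h' => absurd h' hx, fun h' => by omega⟩

/-- A discrete distribution on a grid of mesh `O(r)`, whose weights are within `O(r)` of the
Gaussian density and whose support reaches out to distance of order `1 / r`, has a distribution
function within `O(r)` of the normal one. -/
lemma exists_abs_sum_div_sum_sub_stdNormCDF_le {C c D a : ℝ} (hC : 0 < C) (hc : 0 < c)
    (hD : 0 < D) (ha : 0 < a) :
    ∃ K > 0, ∀ (r t₀ : ℝ) (w : ℕ → ℝ) (n : ℕ), 0 < r → r ≤ 1 → 0 < n → (∀ k < n, 0 < w k) →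
      (∀ k < n, |w k - Real.exp (-(t₀ + k * (D * r)) ^ 2 / 2)| ≤
        C * r * Real.exp (-c * (t₀ + k * (D * r)) ^ 2)) →
      t₀ ≤ -(a / r) → a / r ≤ t₀ + n * (D * r) →
      ∀ x : ℝ, |(∑ k ∈ (Finset.range n).filter (fun k : ℕ => t₀ + k * (D * r) ≤ x), w k) /
        ∑ k ∈ Finset.range n, w k - stdNormCDF x| ≤ K * r := by
  obtain ⟨K₁, hK₁, hsum⟩ := exists_abs_sum_sub_gaussMass_le hC hc hD
  set T : ℝ := √(4 * π) / a with hT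
  have hT0 : 0 < T := by positivity
  set M : ℝ := √(2 * π) with hM
  have hM0 : 0 < M := by positivity
  refine ⟨2 * (K₁ + 2 * T + D) / M, by positivity, ?_⟩
  intro r t₀ w n hr hr1 hn hw0 hw hlo hhi x
  set Δ : ℝ := D * r with hΔ
  have hΔ0 : 0 < Δ := by positivity
  have hs : 0 < a / r := by positivity
  have hTr : √(4 * π) / (a / r) = T * r := by rw [hT]; field_simp
  have hlow : gaussMass t₀ ≤ T * r := hTr ▸ gaussMass_le_of_le_neg hs hlo
  have hhigh : M ≤ gaussMass (t₀ + n * Δ) + T * r := hTr ▸ le_gaussMass_add_of_le hs hhi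
  obtain ⟨J, hJn, hJ⟩ := exists_forall_le_iff_lt (t₀ := t₀) hΔ0.le x n
  have hfilter : (Finset.range n).filter (fun k : ℕ => t₀ + (k : ℝ) * Δ ≤ x) = Finset.range J := by
    ext k
    simp only [Finset.mem_filter, Finset.mem_range]
    exact ⟨fun ⟨h1, h2⟩ => (hJ k h1).1 h2, fun h => ⟨by omega, (hJ k (by omega)).2 h⟩⟩
  rw [hfilter]
  have hF := hsum r t₀ w J hr hr1 fun k hk => hw k (by omega)
  have hFn := hsum r t₀ w n hr hr1 hw
  rw [← hΔ, ← Finset.mul_sum] at hF hFn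
  set F : ℝ := ∑ k ∈ Finset.range J, w k with hFdef
  set Z : ℝ := ∑ k ∈ Finset.range n, w k with hZdef
  have hZ0 : 0 < Z := Finset.sum_pos (fun k hk => hw0 k (Finset.mem_range.1 hk))
    (Finset.nonempty_range_iff.2 hn.ne')
  have hFZ : F ≤ Z := Finset.sum_le_sum_of_subset_of_nonneg (Finset.range_mono hJn)
    fun k hk _ => (hw0 k (Finset.mem_range.1 hk)).le
  have hF0 : 0 ≤ F := Finset.sum_nonneg fun k hk =>
    (hw0 k (lt_of_lt_of_le (Finset.mem_range.1 hk) hJn)).le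
  have hZM : |Δ * Z - M| ≤ (K₁ + 2 * T + D) * r := by
    have h1 := gaussMass_nonneg t₀
    have h2 := gaussMass_le (t₀ + n * Δ)
    have h3 : 0 < D * r := hΔ0
    obtain ⟨h4, h5⟩ := abs_le.1 hFn
    have h6 : 0 < T * r := by positivity
    rw [abs_le]
    constructor <;> nlinarith
  have hFG : |Δ * F - gaussMass x| ≤ (K₁ + 2 * T + D) * r := by
    have key : |gaussMass (t₀ + J * Δ) - gaussMass t₀ - gaussMass x| ≤ T * r + T * r + Δ := by
      have h1 := gaussMass_nonneg t₀
      have h6 : 0 < T * r := by positivity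
      have hx0 := gaussMass_nonneg x
      rcases Nat.eq_zero_or_pos J with hJ0 | hJ0
      · have hxt : x ≤ t₀ := by
          by_contra hlt
          have := (hJ 0 hn).1 (by push_cast; linarith)
          omega
        have := gaussMass_mono hxt
        rw [hJ0, Nat.cast_zero, zero_mul, add_zero, abs_le]
        constructor <;> linarith
      · have hlast := (hJ (J - 1) (by omega)).2 (by omega)
        rw [Nat.cast_sub hJ0, Nat.cast_one] at hlast
        have hup : gaussMass (t₀ + J * Δ) ≤ gaussMass x + Δ := by
          have h7 := gaussMass_sub_le (a := t₀ + (J - 1) * Δ) (b := t₀ + J * Δ) (by linarith)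
          have h8 := gaussMass_mono hlast
          linarith
        have hdown : gaussMass x ≤ gaussMass (t₀ + J * Δ) + T * r := by
          rcases hJn.lt_or_eq with hlt | heq
          · have : x ≤ t₀ + J * Δ := by
              by_contra hx
              exact lt_irrefl J ((hJ J hlt).1 (not_le.1 hx).le)
            linarith [gaussMass_mono this]
          · rw [heq]
            linarith [gaussMass_le x]
        rw [abs_le]
        constructor <;> linarith
    have h9 : Δ * F - gaussMass x = (Δ * F - (gaussMass (t₀ + J * Δ) - gaussMass t₀)) +
        (gaussMass (t₀ + J * Δ) - gaussMass t₀ - gaussMass x) := by ring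
    rw [h9]
    refine (abs_add_le _ _).trans ?_
    linarith
  have hsplit : F / Z - gaussMass x / M =
      ((Δ * F - gaussMass x) + F / Z * (M - Δ * Z)) / M := by
    field_simp
    ring
  have hFZ1 : |F / Z| ≤ 1 := by
    rw [abs_of_nonneg (by positivity), div_le_one hZ0]
    exact hFZ
  rw [stdNormCDF_eq, ← hM, hsplit, abs_div, abs_of_pos hM0, div_le_iff₀ hM0]
  refine (abs_add_le _ _).trans ?_
  have h10 : |F / Z * (M - Δ * Z)| ≤ (K₁ + 2 * T + D) * r := by
    rw [abs_mul, abs_sub_comm]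
    exact (mul_le_of_le_one_left (abs_nonneg _) hFZ1).trans hZM
  have h11 : 2 * (K₁ + 2 * T + D) / M * r * M = 2 * ((K₁ + 2 * T + D) * r) := by field_simp
  rw [h11]
  linarith

lemma levelWeight_pos (p : ℕ) {N k : ℕ} (hk : k ≤ N) (β h : ℝ) : 0 < levelWeight p N β h k :=
  mul_pos (by exact_mod_cast Nat.choose_pos hk) (Real.exp_pos _)

lemma cwProb_mem_Icc (p N : ℕ) (β h : ℝ) (E : Set (Fin N → Bool)) :
    cwProb p N β h E ∈ Set.Icc (0 : ℝ) 1 := by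
  have hw : ∀ x : Fin N → Bool, 0 ≤ cwWeight p N β h x := fun x => (Real.exp_pos _).le
  constructor
  · exact div_nonneg (Finset.sum_nonneg fun x _ => Set.indicator_nonneg (fun y _ => hw y) x)
      (Finset.sum_nonneg fun x _ => hw x)
  · exact div_le_one_of_le₀ (Finset.sum_le_sum fun x _ => Set.indicator_le_self' (fun y _ => hw y) x)
      (Finset.sum_nonneg fun x _ => hw x)

lemma stdNormCDF_mem_Icc (x : ℝ) : stdNormCDF x ∈ Set.Icc (0 : ℝ) 1 := by
  rw [stdNormCDF_eq]
  exact ⟨div_nonneg (gaussMass_nonneg x) (by positivity),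
    div_le_one_of_le₀ (gaussMass_le x) (by positivity)⟩

/-- **Berry–Esseen bound at `p`-regular points.** -/
theorem berry_esseen_regular
    (p : ℕ) (hp : 3 ≤ p) (β h m : ℝ) (hβ : 0 < β) (hh : 0 < h)
    (hreg : pRegular p β h m) :
    ∃ C : ℝ, 0 < C ∧
      ∀ N : ℕ, 1 ≤ N → ∀ x : ℝ,
        |cwProb p N β h
            {σ | (mag σ - N * m) /
                Real.sqrt (-(N : ℝ) / iteratedDeriv 2 (Hfun p β h) m) ≤ x} -
          stdNormCDF x|
          ≤ C * (N : ℝ) ^ (-(1:ℝ)/2) := by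
  obtain ⟨C₁, hC₁, c, hc, N₀, hloc⟩ := exists_abs_levelWeight_div_sub_le hβ hh hreg
  obtain ⟨hm1, hm2⟩ := hreg.1.1.1
  set q : ℝ := iteratedDeriv 2 (Hfun p β h) m with hq
  set l : ℝ := -q with hl
  have hl0 : 0 < l := by linarith [hreg.2]
  set b : ℝ := √l with hb
  have hb0 : 0 < b := Real.sqrt_pos.2 hl0
  have hbb : l = b ^ 2 := (Real.sq_sqrt hl0.le).symm
  have hmin : 0 < min (1 + m) (1 - m) := lt_min (by linarith) (by linarith)
  obtain ⟨K, hK, hmain⟩ := exists_abs_sum_div_sum_sub_stdNormCDF_le (C := C₁) (c := c / l)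
    (D := 2 * b) (a := min (1 + m) (1 - m) * b) hC₁ (by positivity) (by positivity) (by positivity)
  refine ⟨K + √N₀, by positivity, fun N hN x => ?_⟩
  have hN1 : (1 : ℝ) ≤ N := by exact_mod_cast hN
  have hN0 : (0 : ℝ) < N := by linarith
  set s : ℝ := √(N : ℝ) with hs
  have hs1 : 1 ≤ s := Real.one_le_sqrt.2 hN1
  have hs0 : 0 < s := by linarith
  have hss : (N : ℝ) = s ^ 2 := (Real.sq_sqrt hN0.le).symm
  have hrpow : (N : ℝ) ^ (-(1 : ℝ) / 2) = 1 / s := by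
    rw [hs, Real.sqrt_eq_rpow, one_div ((N : ℝ) ^ _), ← Real.rpow_neg hN0.le]
    norm_num
  rw [hrpow]
  rcases lt_or_ge N N₀ with hlt | hge
  · have h1 : s ≤ √N₀ := Real.sqrt_le_sqrt (by exact_mod_cast hlt.le)
    have h2 : 1 ≤ (K + √N₀) * (1 / s) := by
      rw [mul_one_div, le_div_iff₀ hs0]; linarith
    refine le_trans ?_ h2
    have h3 := cwProb_mem_Icc p N β h {σ | (mag σ - N * m) / √(-(N : ℝ) / q) ≤ x}
    have h4 := stdNormCDF_mem_Icc x
    rw [abs_le]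
    constructor <;> linarith [h3.1, h3.2, h4.1, h4.2]
  · obtain ⟨A, hA, hAk⟩ := hloc N hN hge
    have hsig : √(-(N : ℝ) / q) = s / b := by
      rw [show -(N : ℝ) / q = N / l by rw [hl, div_neg, neg_div], Real.sqrt_div hN0.le]
    have hgrid : ∀ k : ℕ, -(N * (1 + m)) / (s / b) + k * (2 * b * (1 / s)) =
        (2 * (k : ℝ) - N - N * m) / √(-(N : ℝ) / q) := by
      intro k
      rw [hsig]
      field_simp
      ring
    have hgrid2 : ∀ k : ℕ, (-(N * (1 + m)) / (s / b) + k * (2 * b * (1 / s))) ^ 2 =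
        l * (N * ((2 * k - N) / N - m) ^ 2) := by
      intro k
      rw [hgrid, hsig, hbb, hss]
      field_simp
    have hmn1 := min_le_left (1 + m) (1 - m)
    have hmn2 := min_le_right (1 + m) (1 - m)
    have hend : -(N * (1 + m)) / (s / b) = -((1 + m) * (b * s)) := by
      rw [hss]; field_simp
    have hbs : 0 < b * s := by positivity
    have hN1s : ((N + 1 : ℕ) : ℝ) * (2 * b * (1 / s)) = 2 * (b * s) + 2 * b / s := by
      push_cast; rw [hss]; field_simp
    have hbs2 : 0 < 2 * b / s := by positivity
    have := hmain (1 / s) (-(N * (1 + m)) / (s / b)) (fun k => levelWeight p N β h k / A) (N + 1)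
      (by positivity) (by rw [div_le_one hs0]; exact hs1) N.succ_pos
      (fun k hk => div_pos (levelWeight_pos p (Nat.lt_succ_iff.1 hk) β h) hA)
      (fun k hk => by
        rw [hgrid2]
        convert hAk k (Nat.lt_succ_iff.1 hk) using 3
        · ring_nf
        · ring
        · field_simp)
      (by
        rw [hend, neg_le_neg_iff, div_div_eq_mul_div, div_one, mul_assoc]
        exact mul_le_mul_of_nonneg_right hmn1 hbs.le)
      (by
        rw [hend, hN1s, div_div_eq_mul_div, div_one, mul_assoc]
        nlinarith)
      x
    classical
    have hprob := cwProb_mag_eq p hN β h {u | (u - N * m) / √(-(N : ℝ) / q) ≤ x}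
    rw [← Finset.sum_div, ← Finset.sum_div, div_div_div_cancel_right₀ hA.ne'] at this
    simp only [hgrid] at this
    have hle : K * (1 / s) ≤ (K + √N₀) * (1 / s) :=
      mul_le_mul_of_nonneg_right (by linarith [Real.sqrt_nonneg (N₀ : ℝ)]) (by positivity)
    refine le_trans (le_of_eq ?_) (this.trans hle)
    congr 2
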